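/- There exists a universal constant c > 0 such that the following holds. Let X ⊂ ℝ^d be finite with |X| = n, let G = (G_1,…,G_k) be any ground-truth k-clustering of X, let C = (C_1,…,C_k) = SingleLinkage(X,k), and let C′ = SingleLinkage(X_m,k) be the clustering obtained from a random subsample X_m of m points drawn uniformly with replacement from X. If m ≥ c·((k/ε²) + n/min_{i∈[k]}|C_i| + ζ_{k,SL}(X))·log(nk/δ), then with probability at least 1 − δ, |cost(C′;G) − cost(C;G)| ≤ ε. -/

import Mathlib

open scoped Classical
open Real

noncomputable section

variable {P : Type*} [MetricSpace P]

/-- The maximum distance between consecutive points of a list (`0` for lists of length `≤ 1`). -/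
def pathCost (p : List P) : ℝ := ((p.zip p.tail).map fun q => dist q.1 q.2).foldr max 0

/-- Min-max (bottleneck) distance between `x` and `y` within the finite set `X`. -/
def minMaxD (X : Finset P) (x y : P) : ℝ :=
  sInf { r | ∃ p : List P, p ≠ [] ∧ p.Nodup ∧ (∀ a ∈ p, a ∈ X) ∧
    p.head? = some x ∧ p.getLast? = some y ∧ r = pathCost p }

/-- `d_MM(S; X) = max_{x,y ∈ S} d_MM(x,y;X)`. -/
def minMaxSet (X : Finset P) (S : Set P) : ℝ :=
  sSup { r | ∃ x ∈ S, ∃ y ∈ S, r = minMaxD X x y }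

/-- One merge step of single linkage at distance threshold `D`. -/
def SLStep (X : Finset P) (D : ℝ) (a b : P) : Prop := a ∈ X ∧ b ∈ X ∧ dist a b ≤ D

/-- Two points lie in a common single-linkage cluster at distance threshold `D`. -/
def SLLinked (X : Finset P) (D : ℝ) : P → P → Prop := Relation.ReflTransGen (SLStep X D)

/-- The merge distance at iteration `i` of single linkage on `X`. -/
def mergeDist (X : Finset P) : ℕ → ℝ
  | 0 => 0
  | (i+1) => sInf { r | ∃ x ∈ X, ∃ y ∈ X, ¬ SLLinked X (mergeDist X i) x y ∧ r = dist x y }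

/-- The clusters of single linkage on `X` at distance threshold `D`. -/
def clustersAt (X : Finset P) (D : ℝ) : Set (Set P) :=
  { C | ∃ x ∈ X, C = { y | y ∈ X ∧ SLLinked X D x y } }

/-- `C` is the `k`-clustering output by SingleLinkage(X,k). -/
def IsSLClustering (X : Finset P) (k : ℕ) (C : Set (Set P)) : Prop :=
  ∃ ℓ : ℕ, C = clustersAt X (mergeDist X ℓ) ∧ C.ncard = k

/-- The output of SingleLinkage(X,k): the clusters at the first iteration at which exactly `k`
clusters remain (junk value `∅` if no iteration leaves exactly `k` clusters). -/
def SLClusters (X : Finset P) (k : ℕ) : Set (Set P) :=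
  if h : ∃ ℓ : ℕ, (clustersAt X (mergeDist X ℓ)).ncard = k then
    clustersAt X (mergeDist X (Nat.find h))
  else ∅

/-- `ζ_{k,SL}(X)`, expressed relative to an enumeration `C` of the single-linkage clusters. -/
def zetaSL {k : ℕ} (X : Finset P) (C : Fin k → Set P) : ℝ :=
  (X.card : ℝ) *
    ((⌈(sInf { r | ∃ i j : Fin k, i ≠ j ∧ r = minMaxSet X (C i ∪ C j) } -
        sSup { r | ∃ t : Fin k, r = minMaxSet X (C t) }) /
        sSup { r | ∃ t : Fin k, r = minMaxSet X (C t) }⌉ : ℝ))⁻¹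

/-- The cost `cost(C;G)` of a `k`-clustering `C` of `S` with respect to a ground-truth
`k`-clustering `G` of `X`:
`(1/|S|)·min_{σ ∈ Sym([k])} #{x ∈ S : ∃ j, x ∈ C_{σ(j)} ∧ x ∉ G_j}`, where the minimum also
ranges over enumerations of the unindexed family `C`. -/
def costSet {k : ℕ} (S : Finset P) (C : Set (Set P)) (Gt : Fin k → Set P) : ℝ :=
  (S.card : ℝ)⁻¹ *
    sInf { c : ℝ | ∃ f : Fin k → Set P, Function.Injective f ∧ Set.range f = C ∧
      ∃ σ : Equiv.Perm (Fin k),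
        c = ({ x ∈ (S : Set P) | ∃ j, x ∈ f (σ j) ∧ x ∉ Gt j }.ncard : ℝ) }

/-- `Gt` is a ground-truth `k`-clustering of `X`: a partition of `X` into `k` disjoint subsets. -/
def IsGroundTruth {k : ℕ} (X : Finset P) (Gt : Fin k → Set P) : Prop :=
  (∀ i, Gt i ⊆ ↑X) ∧ Pairwise (fun i j => Disjoint (Gt i) (Gt j)) ∧ (⋃ i, Gt i) = ↑X

/-- The set of points appearing in a sample `ω` of `m` draws from `X`. -/
def sampleFinset {m : ℕ} (X : Finset P) (ω : Fin m → {x // x ∈ X}) : Finset P :=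
  Finset.image (fun i => (ω i : P)) Finset.univ

/-- Probability of an event under the uniform distribution on a finite type. -/
def unifProb {α : Type*} [Fintype α] (E : Set α) : ℝ :=
  ((Finset.univ.filter fun a => a ∈ E).card : ℝ) / (Fintype.card α : ℝ)

/-! ### Uniform probability on a finite type -/

lemma unifProb_eq_ncard {α : Type*} [Fintype α] (E : Set α) :
    unifProb E = (E.ncard : ℝ) / Fintype.card α := by
  have : E = ((Finset.univ.filter fun a => a ∈ E : Finset α) : Set α) := by ext; simp
  rw [unifProb]
  conv_rhs => rw [this, Set.ncard_coe_finset]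

lemma unifProb_mono {α : Type*} [Fintype α] {E F : Set α} (h : E ⊆ F) :
    unifProb E ≤ unifProb F := by
  rw [unifProb_eq_ncard, unifProb_eq_ncard]
  gcongr
  exact F.toFinite

lemma unifProb_union_le {α : Type*} [Fintype α] (E F : Set α) :
    unifProb (E ∪ F) ≤ unifProb E + unifProb F := by
  rw [unifProb_eq_ncard, unifProb_eq_ncard, unifProb_eq_ncard, ← add_div]
  gcongr
  exact_mod_cast Set.ncard_union_le _ _

lemma unifProb_exists_le {α ι : Type*} [Fintype α] (s : Finset ι) (E : ι → Set α) :
    unifProb {a | ∃ i ∈ s, a ∈ E i} ≤ ∑ i ∈ s, unifProb (E i) := by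
  induction s using Finset.induction_on with
  | empty => simp [unifProb_eq_ncard]
  | insert i s hi ih =>
    rw [Finset.sum_insert hi]
    refine le_trans (unifProb_mono ?_) ((unifProb_union_le _ _).trans (add_le_add_right ih _))
    rintro a ⟨j, hj, ha⟩
    rcases Finset.mem_insert.1 hj with rfl | hj
    · exact Or.inl ha
    · exact Or.inr ⟨j, hj, ha⟩

lemma one_sub_unifProb_compl {α : Type*} [Fintype α] [Nonempty α] (E : Set α) :
    1 - unifProb Eᶜ = unifProb E := by
  have h : (Fintype.card α : ℝ) ≠ 0 := by positivity
  have h2 := Set.ncard_add_ncard_compl E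
  rw [Nat.card_eq_fintype_card] at h2
  rw [unifProb_eq_ncard, unifProb_eq_ncard]
  field_simp
  rw [← h2]
  push_cast
  ring

/-- Markov's inequality for the uniform distribution. -/
lemma unifProb_le_of_sum_le {α : Type*} [Fintype α] (E : Set α) (f : α → ℝ) (v b : ℝ)
    (hf : ∀ a, 0 ≤ f a) (hv : 0 < v) (hE : ∀ a ∈ E, v ≤ f a)
    (hb : ∑ a, f a ≤ Fintype.card α * b) (hb0 : 0 ≤ b) : unifProb E ≤ b / v := by
  unfold unifProb
  rcases (Fintype.card α).eq_zero_or_pos with h0 | h0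
  · simp only [h0, Nat.cast_zero, div_zero]; positivity
  have h0' : (0 : ℝ) < Fintype.card α := by exact_mod_cast h0
  rw [div_le_div_iff₀ h0' hv]
  calc ((Finset.univ.filter fun a => a ∈ E).card : ℝ) * v
      = ∑ a ∈ Finset.univ.filter (fun a => a ∈ E), v := by simp
    _ ≤ ∑ a ∈ Finset.univ.filter (fun a => a ∈ E), f a :=
        Finset.sum_le_sum fun a ha => hE a (by simpa using ha)
    _ ≤ ∑ a, f a := Finset.sum_le_univ_sum_of_nonneg hf
    _ ≤ _ := by linarith

/-! ### Occupancy of uniform draws with replacement -/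

lemma unifProb_avoid_le {α : Type*} [Fintype α] {m : ℕ} [Nonempty α] (A : Finset α) :
    unifProb {ω : Fin m → α | ∀ i, ω i ∉ A} ≤ exp (-(m * A.card / Fintype.card α)) := by
  have hn : (0 : ℝ) < Fintype.card α := by positivity
  have hfil : {ω : Fin m → α | ∀ i, ω i ∉ A} =
      ((Fintype.piFinset fun _ => Aᶜ : Finset (Fin m → α)) : Set (Fin m → α)) := by
    ext; simp
  have hA : A.card ≤ Fintype.card α := Finset.card_le_univ A
  have h1 : unifProb {ω : Fin m → α | ∀ i, ω i ∉ A} =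
      (1 - A.card / Fintype.card α : ℝ) ^ m := by
    rw [unifProb_eq_ncard, hfil, Set.ncard_coe_finset, Fintype.card_piFinset_const, Finset.card_compl, Fintype.card_fun,
      Fintype.card_fin]
    push_cast [Nat.cast_sub hA]
    rw [← div_pow]
    congr 1
    field_simp
  rw [h1]
  have hle : (A.card / Fintype.card α : ℝ) ≤ 1 :=
    (div_le_one hn).2 (by exact_mod_cast hA)
  calc (1 - A.card / Fintype.card α : ℝ) ^ m
      ≤ (exp (-(A.card / Fintype.card α))) ^ m :=
        pow_le_pow_left₀ (by linarith) (one_sub_le_exp_neg _) _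
    _ = _ := by rw [← exp_nat_mul]; congr 1; ring

/-- Exchange a draw equal to `i` with a draw avoiding `i`. -/
def exchangeEquiv {α : Type*} (i : α) : α × {x : α // x ≠ i} ≃ {x : α // x ≠ i} × α where
  toFun p := if h : p.1 = i then (p.2, i) else (⟨p.1, h⟩, p.2)
  invFun p := if h : p.2 = i then (i, p.1) else (p.1, ⟨p.2, h⟩)
  left_inv := by
    rintro ⟨x, y, hy⟩
    by_cases h : x = i
    · subst h; simp
    · simp [h, hy]
  right_inv := by
    rintro ⟨⟨x, hx⟩, y⟩
    by_cases h : y = i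
    · subst h; simp
    · simp [h, hx]

/-- Replacing the draws equal to `i` by independent draws avoiding `i` turns a uniform sample of `α`
into a uniform sample of `α \ {i}`. -/
lemma sum_avoid_eq {α : Type*} [Fintype α] {m : ℕ} (i : α) (Y : (Fin m → α) → ℝ) :
    (Fintype.card α : ℝ) ^ m * ∑ h : Fin m → {x : α // x ≠ i}, Y (fun l => h l) =
      ∑ p : (Fin m → α) × (Fin m → {x : α // x ≠ i}),
        Y (fun l => if p.1 l = i then p.2 l else p.1 l) := by
  have key := Equiv.sum_comp
    (((Equiv.arrowProdEquivProdArrow (Fin m) (fun _ => α) (fun _ => {x : α // x ≠ i})).symm.trans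
      (Equiv.piCongrRight fun _ => exchangeEquiv i)).trans
      (Equiv.arrowProdEquivProdArrow (Fin m) (fun _ => {x : α // x ≠ i}) (fun _ => α)))
    (fun p => Y (fun l => p.1 l))
  have hsum : ∑ p : (Fin m → {x : α // x ≠ i}) × (Fin m → α), Y (fun l => p.1 l) =
      (Fintype.card α : ℝ) ^ m * ∑ h : Fin m → {x : α // x ≠ i}, Y (fun l => h l) := by
    rw [Fintype.sum_prod_type]
    simp only [Finset.sum_const, Finset.card_univ, Fintype.card_fun, Fintype.card_fin,
      nsmul_eq_mul, Nat.cast_pow]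
    rw [Finset.mul_sum]
  rw [← hsum, ← key]
  refine Finset.sum_congr rfl fun p _ => ?_
  congr 1
  ext l
  by_cases h : p.1 l = i <;>
    simp [Equiv.arrowProdEquivProdArrow, exchangeEquiv, h]

/-- `u` to the number of points of `B` appearing in `ω`. -/
def hitWeight {α : Type*} {m : ℕ} (u : ℝ) (B : Finset α) (ω : Fin m → α) : ℝ :=
  ∏ j ∈ B, if j ∈ Set.range ω then u else 1

lemma hitWeight_eq_pow {α : Type*} {m : ℕ} (u : ℝ) (B : Finset α) (ω : Fin m → α) :
    hitWeight u B ω = u ^ (B.filter fun j => j ∈ Set.range ω).card := by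
  simp [hitWeight, Finset.prod_ite]

lemma hitWeight_pos {α : Type*} {m : ℕ} {u : ℝ} (hu : 0 < u) (B : Finset α) (ω : Fin m → α) :
    0 < hitWeight u B ω := by
  rw [hitWeight_eq_pow]; positivity

lemma hitWeight_mono {α : Type*} {m : ℕ} {u : ℝ} (hu : 1 ≤ u) {B : Finset α} {f h : Fin m → α}
    (hfh : ∀ j ∈ B, j ∈ Set.range f → j ∈ Set.range h) : hitWeight u B f ≤ hitWeight u B h := by
  rw [hitWeight_eq_pow, hitWeight_eq_pow]
  refine pow_le_pow_right₀ hu (Finset.card_le_card fun j hj => ?_)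
  rw [Finset.mem_filter] at hj ⊢
  exact ⟨hj.1, hfh j hj.1 hj.2⟩

lemma hitWeight_anti {α : Type*} {m : ℕ} {u : ℝ} (hu0 : 0 ≤ u) (hu : u ≤ 1) {B : Finset α}
    {f h : Fin m → α} (hfh : ∀ j ∈ B, j ∈ Set.range f → j ∈ Set.range h) :
    hitWeight u B h ≤ hitWeight u B f := by
  rw [hitWeight_eq_pow, hitWeight_eq_pow]
  refine pow_le_pow_of_le_one hu0 hu (Finset.card_le_card fun j hj => ?_)
  rw [Finset.mem_filter] at hj ⊢
  exact ⟨hj.1, hfh j hj.1 hj.2⟩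

/-- The probability that a given point of an `n`-point set is missed by `m` uniform draws. -/
def missProb (n m : ℕ) : ℝ := (((n : ℝ) - 1) / n) ^ m

lemma sum_hitWeight_insert_le {α : Type*} [Fintype α] {m : ℕ} [Nonempty α]
    {u : ℝ} (hu : 0 < u) {i : α} {B : Finset α}
    (hi : i ∉ B) :
    ∑ ω : Fin m → α, hitWeight u (insert i B) ω ≤
      (u * (1 - missProb (Fintype.card α) m) + missProb (Fintype.card α) m) *
        ∑ ω : Fin m → α, hitWeight u B ω := by
  have hn : (0 : ℝ) < Fintype.card α := by positivity
  set q := missProb (Fintype.card α) m with hq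
  set H := ∑ h : Fin m → {x : α // x ≠ i}, hitWeight u B (fun l => (h l : α)) with hH
  have hmiss : ∑ ω : Fin m → α, (if i ∈ Set.range ω then 0 else hitWeight u B ω) = H := by
    rw [hH]
    symm
    refine Finset.sum_bij_ne_zero (fun h _ _ => fun l => (h l : α)) (by simp) ?_ ?_ ?_
    · intro a _ _ b _ _ hab
      ext l
      exact congrFun hab l
    · intro ω _ hω
      have hir : i ∉ Set.range ω := fun h => hω (by rw [if_pos h])
      exact ⟨fun l => ⟨ω l, fun h => hir ⟨l, h⟩⟩, Finset.mem_univ _,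
        (hitWeight_pos hu _ _).ne', rfl⟩
    · intro h _ _
      rw [if_neg]
      rintro ⟨l, hl⟩
      exact (h l).2 hl
  have hsplit : ∑ ω : Fin m → α, hitWeight u (insert i B) ω =
      u * ∑ ω : Fin m → α, hitWeight u B ω + (1 - u) * H := by
    rw [← hmiss, Finset.mul_sum, Finset.mul_sum, ← Finset.sum_add_distrib]
    refine Finset.sum_congr rfl fun ω _ => ?_
    have : hitWeight u (insert i B) ω =
        (if i ∈ Set.range ω then u else 1) * hitWeight u B ω := by
      unfold hitWeight
      rw [Finset.prod_insert hi]
    rw [this]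
    split_ifs <;> ring
  have hcard : (Fintype.card {x : α // x ≠ i} : ℝ) = Fintype.card α - 1 := by
    rw [Fintype.card_subtype_compl, Fintype.card_subtype_eq]
    rw [Nat.cast_sub (Fintype.card_pos)]
    simp
  have hfg : ∑ p : (Fin m → α) × (Fin m → {x : α // x ≠ i}), hitWeight u B p.1 =
      ((Fintype.card α : ℝ) - 1) ^ m * ∑ ω : Fin m → α, hitWeight u B ω := by
    rw [Fintype.sum_prod_type]
    simp only [Finset.sum_const, Finset.card_univ, Fintype.card_fun, Fintype.card_fin,
      nsmul_eq_mul, Nat.cast_pow, hcard]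
    rw [Finset.mul_sum]
  have hswap := sum_avoid_eq i (hitWeight (m := m) u B)
  have hrange : ∀ p : (Fin m → α) × (Fin m → {x : α // x ≠ i}), ∀ j ∈ B, j ∈ Set.range p.1 →
      j ∈ Set.range (fun l => if p.1 l = i then (p.2 l : α) else p.1 l) := by
    rintro p j hj ⟨l, rfl⟩
    refine ⟨l, ?_⟩
    have : p.1 l ≠ i := fun h => hi (h ▸ hj)
    simp [this]
  have hqS : q * ∑ ω : Fin m → α, hitWeight u B ω =
      (((Fintype.card α : ℝ) - 1) ^ m * ∑ ω : Fin m → α, hitWeight u B ω) /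
        (Fintype.card α : ℝ) ^ m := by
    rw [hq, missProb, div_pow]; ring
  have hHS : H = ((Fintype.card α : ℝ) ^ m * H) / (Fintype.card α : ℝ) ^ m := by
    field_simp
  have main : (1 - u) * H ≤ (1 - u) * (q * ∑ ω : Fin m → α, hitWeight u B ω) := by
    rcases le_total 1 u with h1 | h1
    · refine mul_le_mul_of_nonpos_left ?_ (by linarith)
      rw [hqS, hHS, hH, hswap, ← hfg]
      gcongr with p
      exact hitWeight_mono h1 (hrange p)
    · refine mul_le_mul_of_nonneg_left ?_ (by linarith)
      rw [hqS, hHS, hH, hswap, ← hfg]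
      gcongr with p
      exact hitWeight_anti hu.le h1 (hrange p)
  rw [hsplit]
  linarith

lemma missProb_nonneg {n : ℕ} (hn : 0 < n) (m : ℕ) : 0 ≤ missProb n m := by
  have : (1 : ℝ) ≤ n := by exact_mod_cast hn
  unfold missProb
  exact pow_nonneg (div_nonneg (by linarith) (by linarith)) _

lemma missProb_le_one {n : ℕ} (hn : 0 < n) (m : ℕ) : missProb n m ≤ 1 := by
  have : (1 : ℝ) ≤ n := by exact_mod_cast hn
  unfold missProb
  exact pow_le_one₀ (div_nonneg (by linarith) (by linarith))
    ((div_le_one (by linarith)).2 (by linarith))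

lemma sum_hitWeight_le {α : Type*} [Fintype α] {m : ℕ} [Nonempty α] {u : ℝ} (hu : 0 < u) (B : Finset α) :
    ∑ ω : Fin m → α, hitWeight u B ω ≤ Fintype.card (Fin m → α) *
      (u * (1 - missProb (Fintype.card α) m) + missProb (Fintype.card α) m) ^ B.card := by
  have h0 := missProb_nonneg (Fintype.card_pos (α := α)) m
  have h1 := missProb_le_one (Fintype.card_pos (α := α)) m
  induction B using Finset.induction_on with
  | empty => simp [hitWeight]
  | insert i B hi ih =>
    refine (sum_hitWeight_insert_le hu hi).trans ?_
    rw [Finset.card_insert_of_notMem hi, pow_succ', mul_left_comm]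
    refine mul_le_mul_of_nonneg_left ih ?_
    have : 0 ≤ u * (1 - missProb (Fintype.card α) m) := mul_nonneg hu.le (by linarith)
    linarith

lemma exp_le_one_add_add_sq_mul_exp_abs (y : ℝ) : exp y ≤ 1 + y + y ^ 2 * exp |y| := by
  have h := Complex.norm_exp_sub_sum_le_norm_mul_exp (y : ℂ) 2
  simp only [Finset.sum_range_succ, Finset.sum_range_zero, pow_zero, pow_one,
    Nat.factorial, Nat.cast_one, div_one, zero_add, Complex.norm_real, Real.norm_eq_abs,
    sq_abs, mul_one] at h
  have h2 : Complex.exp (y : ℂ) - (1 + (y : ℂ)) = ((exp y - (1 + y) : ℝ) : ℂ) := by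
    push_cast; ring
  rw [h2, Complex.norm_real, Real.norm_eq_abs] at h
  have := le_abs_self (exp y - (1 + y))
  linarith

lemma bernoulli_mgf_le {q : ℝ} (h0 : 0 ≤ q) (h1 : q ≤ 1) (s : ℝ) :
    exp (-(s * (1 - q))) * (exp s * (1 - q) + q) ≤ exp ((1 - q) * q * s ^ 2 * exp |s|) := by
  have e1 : exp (-(s * (1 - q))) * (exp s * (1 - q) + q) =
      (1 - q) * exp (s * q) + q * exp (-(s * (1 - q))) := by
    have : exp (s * q) = exp (-(s * (1 - q))) * exp s := by rw [← exp_add]; congr 1; ring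
    rw [this]; ring
  have a1 := exp_le_one_add_add_sq_mul_exp_abs (s * q)
  have a2 := exp_le_one_add_add_sq_mul_exp_abs (-(s * (1 - q)))
  have b1 : exp |s * q| ≤ exp |s| := by
    rw [exp_le_exp, abs_mul, abs_of_nonneg h0]
    exact mul_le_of_le_one_right (abs_nonneg _) h1
  have b2 : exp |-(s * (1 - q))| ≤ exp |s| := by
    rw [exp_le_exp, abs_neg, abs_mul, abs_of_nonneg (by linarith : 0 ≤ 1 - q)]
    exact mul_le_of_le_one_right (abs_nonneg _) (by linarith)
  have c1 : exp (s * q) ≤ 1 + s * q + (s * q) ^ 2 * exp |s| :=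
    a1.trans (by gcongr)
  have c2 : exp (-(s * (1 - q))) ≤ 1 + -(s * (1 - q)) + (-(s * (1 - q))) ^ 2 * exp |s| :=
    a2.trans (by gcongr)
  rw [e1]
  calc (1 - q) * exp (s * q) + q * exp (-(s * (1 - q)))
      ≤ (1 - q) * (1 + s * q + (s * q) ^ 2 * exp |s|) +
        q * (1 + -(s * (1 - q)) + (-(s * (1 - q))) ^ 2 * exp |s|) := by gcongr
    _ = (1 - q) * q * s ^ 2 * exp |s| + 1 := by ring
    _ ≤ _ := add_one_le_exp _

/-- Chernoff bound for the number of points of `B` that are hit. -/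
lemma unifProb_hit_deviation_le {α : Type*} [Fintype α] {m : ℕ} [Nonempty α] (B : Finset α) (s t : ℝ) :
    unifProb {ω : Fin m → α | t ≤ s * (((B.filter fun j => j ∈ Set.range ω).card : ℝ) -
        (1 - missProb (Fintype.card α) m) * B.card)} ≤
      exp (B.card * ((1 - missProb (Fintype.card α) m) * missProb (Fintype.card α) m *
        s ^ 2 * exp |s|) - t) := by
  have h0 := missProb_nonneg (Fintype.card_pos (α := α)) m
  have h1 := missProb_le_one (Fintype.card_pos (α := α)) m
  set q := missProb (Fintype.card α) m with hq
  have hw : 0 ≤ exp s * (1 - q) + q := by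
    have : 0 ≤ exp s * (1 - q) := mul_nonneg (exp_pos _).le (by linarith)
    linarith
  have := unifProb_le_of_sum_le
    {ω : Fin m → α | t ≤ s * (((B.filter fun j => j ∈ Set.range ω).card : ℝ) -
        (1 - q) * B.card)}
    (fun ω => hitWeight (exp s) B ω) (exp (t + s * (1 - q) * B.card))
    ((exp s * (1 - q) + q) ^ B.card) (fun ω => (hitWeight_pos (exp_pos _) _ _).le)
    (exp_pos _) ?_ (sum_hitWeight_le (exp_pos _) B) (pow_nonneg hw _)
  · refine this.trans ?_
    rw [div_eq_mul_inv, ← exp_neg]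
    have e : exp (-(t + s * (1 - q) * B.card)) =
        exp (-(s * (1 - q))) ^ B.card * exp (-t) := by
      rw [← exp_nat_mul, ← exp_add]; congr 1; ring
    rw [e, ← mul_assoc, mul_comm (_ ^ _), ← mul_pow, exp_sub, div_eq_mul_inv, ← exp_neg,
      exp_nat_mul]
    refine mul_le_mul_of_nonneg_right ?_ (exp_pos _).le
    exact pow_le_pow_left₀ (mul_nonneg (exp_pos _).le hw) (bernoulli_mgf_le h0 h1 s) _
  · intro ω hω
    rw [Set.mem_ofPred_eq] at hω
    rw [hitWeight_eq_pow, ← exp_nat_mul, exp_le_exp]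
    linarith

lemma missProb_le_exp {n : ℕ} (hn : 0 < n) (m : ℕ) : missProb n m ≤ exp (-((m : ℝ) / n)) := by
  have h1 : (1 : ℝ) ≤ n := by exact_mod_cast hn
  have e : ((n : ℝ) - 1) / n = 1 - 1 / n := by field_simp
  have : exp (-((m : ℝ) / n)) = exp (-(1 / n : ℝ)) ^ m := by
    rw [← exp_nat_mul]; congr 1; ring
  rw [this, missProb]
  refine pow_le_pow_left₀ (div_nonneg (by linarith) (by linarith)) ?_ _
  rw [e]
  exact one_sub_le_exp_neg _

lemma one_sub_le_missProb {n : ℕ} (hn : 0 < n) (m : ℕ) : 1 - (m : ℝ) / n ≤ missProb n m := by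
  have h1 : (1 : ℝ) ≤ n := by exact_mod_cast hn
  have hle : (1 : ℝ) / n ≤ 1 := (div_le_one (by linarith)).2 h1
  have := one_add_mul_le_pow (a := -(1 / n : ℝ)) (by linarith) m
  have e : ((n : ℝ) - 1) / n = 1 + -(1 / n) := by field_simp; ring
  rw [missProb, e]
  refine le_trans (le_of_eq ?_) this
  ring

lemma half_div_le_max_mul_hitProb {n : ℕ} (hn : 0 < n) (m : ℕ) :
    (m : ℝ) / n / 2 ≤ max 1 ((m : ℝ) / n) * (1 - missProb n m) := by
  have hq := missProb_le_exp hn m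
  set x : ℝ := (m : ℝ) / n with hx
  have hx0 : 0 ≤ x := by positivity
  have he : exp (-x) ≤ 1 / (1 + x) := by
    rw [exp_neg, ← one_div]
    exact one_div_le_one_div_of_le (by linarith) (by linarith [add_one_le_exp x])
  rcases le_total x 1 with h | h
  · rw [max_eq_left h]
    have : 1 / (1 + x) ≤ 1 - x / 2 := by
      rw [div_le_iff₀ (by linarith)]; nlinarith
    linarith
  · rw [max_eq_right h]
    have : 1 / (1 + x) ≤ 1 / 2 := one_div_le_one_div_of_le (by norm_num) (by linarith)
    nlinarith

lemma variance_mul_max_sq_le {n : ℕ} (hn : 0 < n) (m : ℕ) :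
    (1 - missProb n m) * missProb n m * max 1 ((m : ℝ) / n) ^ 2 *
      exp (max 1 ((m : ℝ) / n) / 16) ≤ exp (1 / 16) * ((m : ℝ) / n) := by
  have hq := missProb_le_exp hn m
  have hq2 := one_sub_le_missProb hn m
  have h0 := missProb_nonneg hn m
  have h1 := missProb_le_one hn m
  set q := missProb n m
  set x : ℝ := (m : ℝ) / n with hx
  have hx0 : 0 ≤ x := by positivity
  have he : 0 < exp (1 / 16) := exp_pos _
  rcases le_total x 1 with h | h
  · rw [max_eq_left h]
    have : (1 - q) * q ≤ x * 1 := mul_le_mul (by linarith) h1 h0 hx0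
    nlinarith
  · rw [max_eq_right h]
    have hp : (1 - q) * q ≤ exp (-x) := by nlinarith
    have hz : x ≤ exp (15 / 16 * x) := by
      have e : exp (15 / 16 * x) = exp (15 / 32 * x) ^ 2 := by
        rw [← exp_nat_mul]; congr 1; push_cast; ring
      have := add_one_le_exp (15 / 32 * x)
      rw [e]
      calc x ≤ (15 / 32 * x + 1) ^ 2 := by nlinarith
        _ ≤ _ := pow_le_pow_left₀ (by positivity) this 2
    have hz2 : exp (-x) * exp (x / 16) * x ≤ 1 := by
      have e : exp (-x) * exp (x / 16) = (exp (15 / 16 * x))⁻¹ := by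
        rw [← exp_neg, ← exp_add]; congr 1; ring
      rw [e, inv_mul_le_iff₀ (exp_pos _)]
      linarith
    calc (1 - q) * q * x ^ 2 * exp (x / 16) ≤ exp (-x) * x ^ 2 * exp (x / 16) := by gcongr
      _ = (exp (-x) * exp (x / 16) * x) * x := by ring
      _ ≤ exp (1 / 16) * x := by
        have : (1 : ℝ) ≤ exp (1 / 16) := one_le_exp (by norm_num)
        gcongr
        linarith

/-- The number of distinct sampled points of `B` concentrates at the scale needed to estimate
frequencies among the distinct sampled points up to `ε`. -/
lemma unifProb_abs_hit_deviation_le {α : Type*} [Fintype α] {m : ℕ} [Nonempty α] (B : Finset α)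
    {ε : ℝ} (hε : 0 < ε) (hε1 : ε ≤ 1) :
    unifProb {ω : Fin m → α |
        ε * Fintype.card α * (1 - missProb (Fintype.card α) m) / 4 <
          |((B.filter fun j => j ∈ Set.range ω).card : ℝ) -
            (1 - missProb (Fintype.card α) m) * B.card|} ≤
      2 * exp (-(ε ^ 2 * m / 300)) := by
  have hn : 0 < Fintype.card α := Fintype.card_pos
  have h0 := missProb_nonneg hn m
  have h1 := missProb_le_one hn m
  have hlow := half_div_le_max_mul_hitProb hn m
  have hvar := variance_mul_max_sq_le hn m
  have hB : (B.card : ℝ) ≤ Fintype.card α := by exact_mod_cast Finset.card_le_univ B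
  set n := Fintype.card α with hnn
  set q := missProb n m with hq
  set y := max 1 ((m : ℝ) / n) with hy
  have hy1 : 1 ≤ y := le_max_left _ _
  have hn' : (0 : ℝ) < n := by exact_mod_cast hn
  set s := ε * y / 16 with hs
  have hs0 : 0 < s := by positivity
  set T := ε * n * (1 - q) / 4 with hT
  have hexp : ∀ s' : ℝ, |s'| = s → B.card * ((1 - q) * q * s' ^ 2 * exp |s'|) - s * T ≤
      -(ε ^ 2 * m / 300) := by
    intro s' hs'
    rw [hs', ← sq_abs s', hs']
    have e16 : exp (1 / 16) ≤ 1.1 := by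
      have h := exp_bound_div_one_sub_of_interval (x := 1 / 16) (by norm_num) (by norm_num)
      refine h.trans (by norm_num)
    have a1 : exp s ≤ exp (y / 16) := by
      rw [exp_le_exp, hs]; nlinarith
    have a2 : B.card * ((1 - q) * q * s ^ 2 * exp s) ≤
        n * ((1 - q) * q * s ^ 2 * exp (y / 16)) := by
      have : 0 ≤ 1 - q := by linarith
      gcongr
    have a3 : n * ((1 - q) * q * s ^ 2 * exp (y / 16)) =
        n * (ε ^ 2 / 256) * ((1 - q) * q * y ^ 2 * exp (y / 16)) := by rw [hs]; ring
    have a4 : n * (ε ^ 2 / 256) * ((1 - q) * q * y ^ 2 * exp (y / 16)) ≤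
        n * (ε ^ 2 / 256) * (1.1 * ((m : ℝ) / n)) := by
      exact mul_le_mul_of_nonneg_left
        (hvar.trans (mul_le_mul_of_nonneg_right e16 (by positivity))) (by positivity)
    have a5 : n * (ε ^ 2 / 256) * (1.1 * ((m : ℝ) / n)) = ε ^ 2 * m * (1.1 / 256) := by
      field_simp
    have a6 : s * T = ε ^ 2 * n / 64 * (y * (1 - q)) := by rw [hs, hT]; ring
    have a7 : ε ^ 2 * n / 64 * ((m : ℝ) / n / 2) ≤ ε ^ 2 * n / 64 * (y * (1 - q)) := by gcongr
    have a8 : ε ^ 2 * n / 64 * ((m : ℝ) / n / 2) = ε ^ 2 * m / 128 := by field_simp; ring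
    have a9 : 0 ≤ ε ^ 2 * m := by positivity
    linarith
  refine (unifProb_mono ?_).trans ((unifProb_union_le _ _).trans (add_le_add
    (unifProb_hit_deviation_le B s (s * T)) (unifProb_hit_deviation_le B (-s) (s * T)))) |>.trans ?_
  · intro ω hω
    rw [Set.mem_ofPred_eq, lt_abs] at hω
    rcases hω with hω | hω
    · left
      rw [Set.mem_ofPred_eq]
      exact mul_le_mul_of_nonneg_left hω.le hs0.le
    · right
      rw [Set.mem_ofPred_eq, neg_mul, ← mul_neg]
      exact mul_le_mul_of_nonneg_left hω.le hs0.le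
  · have b1 := hexp s (abs_of_pos hs0)
    have b2 := hexp (-s) (by rw [abs_neg, abs_of_pos hs0])
    have := add_le_add (exp_le_exp.2 b1) (exp_le_exp.2 b2)
    linarith

/-! ### Threshold graphs and bottleneck distances -/

section Linkage

variable {P : Type*} [MetricSpace P] {X : Finset P}

lemma pathCost_le_iff {p : List P} {D : ℝ} (hD : 0 ≤ D) :
    pathCost p ≤ D ↔ p.IsChain fun a b => dist a b ≤ D := by
  induction p with
  | nil => simp [pathCost, hD]
  | cons a l ih =>
    cases l with
    | nil => simp [pathCost, hD]
    | cons b l =>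
      rw [List.isChain_cons_cons, ← ih]
      simp [pathCost]

lemma pathCost_nonneg (p : List P) : 0 ≤ pathCost p := by
  unfold pathCost
  induction (p.zip p.tail).map fun q => dist q.1 q.2 with
  | nil => simp
  | cons a l ih => exact le_max_of_le_right ih

lemma pathCost_mem {p : List P} (hp : ∀ a ∈ p, a ∈ X) :
    pathCost p ∈ insert 0 (Set.image2 dist (X : Set P) X) := by
  induction p with
  | nil => simp [pathCost]
  | cons a l ih =>
    cases l with
    | nil => simp [pathCost]
    | cons b l =>
      have e : pathCost (a :: b :: l) = max (dist a b) (pathCost (b :: l)) := by simp [pathCost]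
      rw [e]
      rcases max_choice (dist a b) (pathCost (b :: l)) with h | h
      · rw [h]
        exact Or.inr ⟨a, hp a (by simp), b, hp b (by simp), rfl⟩
      · rw [h]
        exact ih fun c hc => hp c (List.mem_cons_of_mem _ hc)

lemma SLLinked.mono {D D' : ℝ} (h : D ≤ D') {x y : P} (hxy : SLLinked X D x y) :
    SLLinked X D' x y :=
  Relation.ReflTransGen.mono (fun _ _ hab => ⟨hab.1, hab.2.1, hab.2.2.trans h⟩) _ _ hxy

lemma SLLinked.symm {D : ℝ} {x y : P} (hxy : SLLinked X D x y) : SLLinked X D y x := by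
  induction hxy with
  | refl => exact Relation.ReflTransGen.refl
  | tail _ h ih =>
    exact Relation.ReflTransGen.head ⟨h.2.1, h.1, by rw [dist_comm]; exact h.2.2⟩ ih

lemma SLLinked.trans {D : ℝ} {x y z : P} (hxy : SLLinked X D x y) (hyz : SLLinked X D y z) :
    SLLinked X D x z :=
  Relation.ReflTransGen.trans hxy hyz

lemma SLLinked.of_dist_le {D : ℝ} {x y : P} (hx : x ∈ X) (hy : y ∈ X) (h : dist x y ≤ D) :
    SLLinked X D x y :=
  Relation.ReflTransGen.single ⟨hx, hy, h⟩

lemma SLLinked.mem {D : ℝ} {x y : P} (hxy : SLLinked X D x y) (hx : x ∈ X) : y ∈ X := by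
  induction hxy with
  | refl => exact hx
  | tail _ h _ => exact h.2.1

lemma slLinked_of_path {D : ℝ} {p : List P} (hp : ∀ a ∈ p, a ∈ X)
    (hc : p.IsChain fun a b => dist a b ≤ D) {x y : P} (hx : p.head? = some x)
    (hy : p.getLast? = some y) : SLLinked X D x y := by
  induction p generalizing x with
  | nil => simp at hx
  | cons a l ih =>
    obtain rfl : a = x := by simpa using hx
    cases l with
    | nil =>
      obtain rfl : a = y := by simpa using hy
      exact Relation.ReflTransGen.refl
    | cons b l =>
      rw [List.isChain_cons_cons] at hc
      refine Relation.ReflTransGen.head ⟨hp a (by simp), hp b (by simp), hc.1⟩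
        (ih (fun c hc => hp c (List.mem_cons_of_mem _ hc)) hc.2 (x := b) rfl ?_)
      simpa using hy

lemma SLLinked.exists_path {D : ℝ} {x y : P} (h : SLLinked X D x y) (hy : y ∈ X) :
    ∃ p : List P, p.Nodup ∧ (∀ a ∈ p, a ∈ X) ∧ p.head? = some x ∧ p.getLast? = some y ∧
      p.IsChain fun a b => dist a b ≤ D := by
  induction h using Relation.ReflTransGen.head_induction_on with
  | refl => exact ⟨[y], by simp, by simpa using hy, by simp, by simp, by simp⟩
  | @head a b hab _ ih =>
    obtain ⟨p, h1, h2, h3, h4, h5⟩ := ih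
    by_cases ha : a ∈ p
    · obtain ⟨s, t, rfl⟩ := List.append_of_mem ha
      refine ⟨a :: t, h1.of_append_right, fun c hc => h2 c (List.mem_append_right _ hc), rfl, ?_,
        h5.right_of_append⟩
      simpa using h4
    · cases p with
      | nil => simp at h3
      | cons b' l =>
        obtain rfl : b' = b := by simpa using h3
        refine ⟨a :: b' :: l, List.nodup_cons.2 ⟨ha, h1⟩, ?_, rfl, ?_,
          List.isChain_cons_cons.2 ⟨hab.2.2, h5⟩⟩
        · intro c hc
          rcases List.mem_cons.1 hc with rfl | hc
          · exact hab.1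
          · exact h2 c hc
        · simpa using h4

lemma minMaxD_le_iff {D : ℝ} (hD : 0 ≤ D) {x y : P} (hx : x ∈ X) (hy : y ∈ X) :
    minMaxD X x y ≤ D ↔ SLLinked X D x y := by
  unfold minMaxD
  set V := { r | ∃ p : List P, p ≠ [] ∧ p.Nodup ∧ (∀ a ∈ p, a ∈ X) ∧
    p.head? = some x ∧ p.getLast? = some y ∧ r = pathCost p } with hV
  have hmem : ∀ D', SLLinked X D' x y → 0 ≤ D' → ∃ v ∈ V, v ≤ D' := by
    intro D' h h0
    obtain ⟨p, h1, h2, h3, h4, h5⟩ := h.exists_path hy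
    exact ⟨_, ⟨p, by rintro rfl; simp at h3, h1, h2, h3, h4, rfl⟩, (pathCost_le_iff h0).2 h5⟩
  constructor
  · intro h
    have hne : V.Nonempty := by
      obtain ⟨v, hv, _⟩ := hmem _ (SLLinked.of_dist_le hx hy le_rfl) dist_nonneg
      exact ⟨v, hv⟩
    have hfin : V.Finite := by
      refine Set.Finite.subset
        ((X.finite_toSet.image2 dist X.finite_toSet).insert (0 : ℝ)) ?_
      rintro _ ⟨p, -, -, h2, -, -, rfl⟩
      exact pathCost_mem h2
    obtain ⟨p, -, -, h2, h3, h4, h5⟩ := hne.csInf_mem hfin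
    rw [h5] at h
    exact slLinked_of_path h2 ((pathCost_le_iff hD).1 h) h3 h4
  · intro h
    obtain ⟨v, hv, hvD⟩ := hmem D h hD
    refine (csInf_le ⟨0, ?_⟩ hv).trans hvD
    rintro _ ⟨p, -, -, -, -, -, rfl⟩
    exact pathCost_nonneg p

lemma minMaxSet_le_iff {D : ℝ} (hD : 0 ≤ D) {S : Set P} (hS : S ⊆ X) (hne : S.Nonempty) :
    minMaxSet X S ≤ D ↔ ∀ x ∈ S, ∀ y ∈ S, SLLinked X D x y := by
  unfold minMaxSet
  have e : { r | ∃ x ∈ S, ∃ y ∈ S, r = minMaxD X x y } = Set.image2 (minMaxD X) S S := by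
    ext r
    simp only [Set.mem_ofPred_eq, Set.mem_image2, eq_comm (a := r)]
  have hSf : S.Finite := X.finite_toSet.subset hS
  rw [e, csSup_le_iff (hSf.image2 _ hSf).bddAbove (hne.image2 hne)]
  simp only [Set.forall_mem_image2]
  refine forall₂_congr fun x hx => forall₂_congr fun y hy => ?_
  exact minMaxD_le_iff hD (hS hx) (hS hy)

lemma minMaxSet_nonneg (S : Set P) : 0 ≤ minMaxSet X S := by
  refine Real.sSup_nonneg ?_
  rintro _ ⟨x, -, y, -, rfl⟩
  refine Real.sInf_nonneg ?_
  rintro _ ⟨p, -, -, -, -, -, rfl⟩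
  exact pathCost_nonneg p

/-! ### The single-linkage procedure -/

lemma mergeDist_nonneg (X : Finset P) (l : ℕ) : 0 ≤ mergeDist X l := by
  cases l with
  | zero => exact le_rfl
  | succ l =>
    refine Real.sInf_nonneg ?_
    rintro _ ⟨x, -, y, -, -, rfl⟩
    exact dist_nonneg

lemma clustersAt_congr {D D' : ℝ} (h : ∀ x y, SLLinked X D x y ↔ SLLinked X D' x y) :
    clustersAt X D = clustersAt X D' := by
  unfold clustersAt
  simp only [h]

lemma clustersAt_eq_image (D : ℝ) :
    clustersAt X D = (fun x => {y | y ∈ X ∧ SLLinked X D x y}) '' (X : Set P) := by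
  ext c
  simp [clustersAt, eq_comm]

/-- Every threshold graph's components appear at some iteration of single linkage. -/
lemma exists_clustersAt_mergeDist_eq {D : ℝ} (hD : 0 ≤ D) :
    ∃ l, clustersAt X (mergeDist X l) = clustersAt X D := by
  by_contra! hcon
  have key : ∀ l, mergeDist X l ≤ D →
      mergeDist X l < mergeDist X (l + 1) ∧ mergeDist X (l + 1) ≤ D := by
    intro l hl
    set V := { r | ∃ x ∈ X, ∃ y ∈ X, ¬ SLLinked X (mergeDist X l) x y ∧ r = dist x y } with hV
    have hVm : mergeDist X (l + 1) = sInf V := rfl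
    have hfin : V.Finite := by
      refine (X.finite_toSet.image2 dist X.finite_toSet).subset ?_
      rintro _ ⟨x, hx, y, hy, -, rfl⟩
      exact ⟨x, hx, y, hy, rfl⟩
    obtain ⟨v, hv, hvD⟩ : ∃ v ∈ V, v ≤ D := by
      by_contra! hno
      refine hcon l (clustersAt_congr fun x y => ⟨SLLinked.mono hl, fun h => ?_⟩)
      induction h with
      | refl => exact Relation.ReflTransGen.refl
      | tail _ hab ih =>
        refine ih.trans ?_
        by_contra hn
        exact absurd hab.2.2 (not_le.2 (hno _ ⟨_, hab.1, _, hab.2.1, hn, rfl⟩))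
    rw [hVm]
    refine ⟨?_, (csInf_le hfin.bddBelow hv).trans hvD⟩
    obtain ⟨x, hx, y, hy, hn, he⟩ := Set.Nonempty.csInf_mem ⟨v, hv⟩ hfin
    rw [he]
    by_contra! hle
    exact hn (SLLinked.of_dist_le hx hy hle)
  have hle : ∀ l, mergeDist X l ≤ D := by
    intro l
    induction l with
    | zero => exact hD
    | succ l ih => exact (key l ih).2
  have hmono : StrictMono (mergeDist X) := strictMono_nat_of_lt_succ fun l => (key l (hle l)).1
  refine Set.infinite_range_of_injective hmono.injective ?_
  refine ((X.finite_toSet.image2 dist X.finite_toSet).insert (0 : ℝ)).subset ?_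
  rintro _ ⟨l, rfl⟩
  cases l with
  | zero => exact Or.inl rfl
  | succ l =>
    right
    set V := { r | ∃ x ∈ X, ∃ y ∈ X, ¬ SLLinked X (mergeDist X l) x y ∧ r = dist x y } with hV
    have hsub : V ⊆ Set.image2 dist (X : Set P) X := by
      rintro _ ⟨x, hx, y, hy, -, rfl⟩
      exact ⟨x, hx, y, hy, rfl⟩
    have hne : V.Nonempty := by
      by_contra hno
      rw [Set.not_nonempty_iff_eq_empty] at hno
      have h0 : mergeDist X (l + 1) = 0 := by
        change sInf V = 0
        rw [hno, Real.sInf_empty]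
      have := (key l (hle l)).1
      rw [h0] at this
      exact absurd this (not_lt.2 (mergeDist_nonneg X l))
    exact hsub (hne.csInf_mem ((X.finite_toSet.image2 dist X.finite_toSet).subset hsub))

lemma clustersAt_finite (D : ℝ) : (clustersAt X D).Finite := by
  rw [clustersAt_eq_image]
  exact X.finite_toSet.image _

/-- Two threshold graphs with equally many components have the same components. -/
lemma clustersAt_eq_of_ncard_eq {D D' : ℝ} (hle : D ≤ D')
    (h : (clustersAt X D).ncard = (clustersAt X D').ncard) :
    clustersAt X D = clustersAt X D' := by
  set F : Set P → Set P := fun c => {y | y ∈ X ∧ ∃ x ∈ c, SLLinked X D' x y} with hF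
  have hFc : ∀ x ∈ X, F {y | y ∈ X ∧ SLLinked X D x y} = {y | y ∈ X ∧ SLLinked X D' x y} := by
    intro x hx
    ext y
    constructor
    · rintro ⟨hy, z, ⟨-, hxz⟩, hzy⟩
      exact ⟨hy, (hxz.mono hle).trans hzy⟩
    · rintro ⟨hy, hxy⟩
      exact ⟨hy, x, ⟨hx, Relation.ReflTransGen.refl⟩, hxy⟩
  have himg : F '' clustersAt X D = clustersAt X D' := by
    rw [clustersAt_eq_image, clustersAt_eq_image, Set.image_image]
    exact Set.image_congr hFc
  have hinj := Set.injOn_of_ncard_image_eq (by rw [himg, h]) (clustersAt_finite (X := X) D)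
  refine clustersAt_congr fun x y => ⟨SLLinked.mono hle, fun hxy => ?_⟩
  rcases Relation.ReflTransGen.cases_head hxy with rfl | ⟨_, hstep, _⟩
  · exact Relation.ReflTransGen.refl
  have hx : x ∈ X := hstep.1
  have hy : y ∈ X := hxy.mem hx
  have e : F {z | z ∈ X ∧ SLLinked X D x z} = F {z | z ∈ X ∧ SLLinked X D y z} := by
    rw [hFc x hx, hFc y hy]
    ext z
    exact and_congr_right fun _ => ⟨hxy.symm.trans, hxy.trans⟩
  have := hinj ⟨x, hx, rfl⟩ ⟨y, hy, rfl⟩ e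
  have hmem : y ∈ {z | z ∈ X ∧ SLLinked X D x z} := by
    rw [this]
    exact ⟨hy, Relation.ReflTransGen.refl⟩
  exact hmem.2

/-- Single linkage outputs the components of any threshold graph having `k` components. -/
lemma SLClusters_eq_clustersAt {k : ℕ} {D : ℝ} (hD : 0 ≤ D) (h : (clustersAt X D).ncard = k) :
    SLClusters X k = clustersAt X D := by
  obtain ⟨l, hl⟩ := exists_clustersAt_mergeDist_eq (X := X) hD
  have hex : ∃ l, (clustersAt X (mergeDist X l)).ncard = k := ⟨l, by rw [hl, h]⟩
  rw [SLClusters, dif_pos hex]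
  have hk := Nat.find_spec hex
  rcases le_total (mergeDist X (Nat.find hex)) D with hle | hle
  · exact clustersAt_eq_of_ncard_eq hle (hk.trans h.symm)
  · exact (clustersAt_eq_of_ncard_eq hle (h.trans hk.symm)).symm

/-! ### Stability of the clusters under subsampling -/

/-- In the component of `x` at threshold `r` there are `N` points within `(N - 1) * r` of `x`. -/
lemma exists_near_subset {r : ℝ} (hr : 0 ≤ r) {x : P} {K : Finset P}
    (hK : ∀ y, y ∈ K ↔ SLLinked X r x y) {N : ℕ} (hN : 1 ≤ N) (hNK : N ≤ K.card) :
    ∃ A ⊆ K, x ∈ A ∧ A.card = N ∧ ∀ a ∈ A, dist x a ≤ ((N : ℝ) - 1) * r := by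
  induction N, hN using Nat.le_induction with
  | base =>
    exact ⟨{x}, by simpa using (hK x).2 Relation.ReflTransGen.refl, by simp, by simp, by simp⟩
  | succ N hN ih =>
    obtain ⟨A, hAK, hxA, hAN, hAd⟩ := ih (by omega)
    obtain ⟨a, ha, b, hb, hab⟩ : ∃ a ∈ A, ∃ b ∉ A, SLStep X r a b := by
      by_contra! hno
      have hKA : K ⊆ A := by
        intro y hy
        have hxy := (hK y).1 hy
        clear hy
        induction hxy with
        | refl => exact hxA
        | tail _ hbc ih =>
          by_contra hc
          exact hno _ ih _ hc hbc
      have := Finset.card_le_card hKA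
      omega
    refine ⟨insert b A, ?_, Finset.mem_insert_of_mem hxA, ?_, ?_⟩
    · refine Finset.insert_subset ((hK b).2 ?_) hAK
      exact Relation.ReflTransGen.tail ((hK a).1 (hAK ha)) hab
    · rw [Finset.card_insert_of_notMem hb, hAN]
    · intro c hc
      push_cast
      rcases Finset.mem_insert.1 hc with rfl | hc
      · have := dist_triangle x a c
        have := hAd a ha
        have := hab.2.2
        linarith
      · have := hAd c hc
        linarith

/-- If every point of `X` has a sampled representative nearby in its own cluster, and the clusters
are well separated, then single linkage on the sample returns the traces of the clusters. -/
lemma SLClusters_subsample {k : ℕ} {C : Fin k → Set P} {r R η : ℝ} (hr : 0 ≤ r) (hη : 0 ≤ η)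
    (hηR : η + r + η < R) (hcover : ∀ x ∈ X, ∃ t, x ∈ C t)
    (hne : ∀ t, (C t).Nonempty) (hlink : ∀ t, ∀ x ∈ C t, ∀ y ∈ C t, SLLinked X r x y)
    (hsep : ∀ i j, i ≠ j → ∀ x ∈ C i, ∀ y ∈ C j, R ≤ dist x y) {S : Finset P} (hSX : S ⊆ X)
    (hS : ∀ t, ∀ x ∈ C t, ∃ s ∈ S, s ∈ C t ∧ dist x s ≤ η) :
    SLClusters S k = Set.range (fun t => C t ∩ S) ∧
      Function.Injective (fun t => C t ∩ (S : Set P)) := by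
  have hstay : ∀ Y : Finset P, Y ⊆ X → ∀ t x y, x ∈ C t →
      SLLinked Y (η + r + η) x y → y ∈ C t := by
    intro Y hY t x y hx hxy
    induction hxy with
    | refl => exact hx
    | tail _ h ih =>
      obtain ⟨j, hj⟩ := hcover _ (hY h.2.1)
      rcases eq_or_ne t j with rfl | hne
      · exact hj
      · have := hsep t j hne _ ih _ hj
        linarith [h.2.2]
  have hlinkS : ∀ t x, x ∈ C t → x ∈ S → ∀ y, SLLinked X r x y → ∀ s ∈ S, dist y s ≤ η →
      SLLinked S (η + r + η) x s := by
    intro t x hx hxS y hxy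
    induction hxy with
    | refl =>
      intro s hs hd
      exact SLLinked.of_dist_le hxS hs (by linarith)
    | @tail b c hxb hbc ih =>
      intro s hs hd
      have hb : b ∈ C t := hstay X (Finset.Subset.refl _) t x b hx
        (SLLinked.mono (by linarith) hxb)
      obtain ⟨s', hs', -, hd'⟩ := hS t b hb
      refine (ih s' hs' hd').trans (SLLinked.of_dist_le hs' hs ?_)
      have h1 := dist_triangle4 s' b c s
      rw [dist_comm s' b] at h1
      linarith [hbc.2.2]
  have hcl : ∀ t, ∀ x ∈ C t, x ∈ S →
      {y | y ∈ S ∧ SLLinked S (η + r + η) x y} = C t ∩ S := by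
    intro t x hx hxS
    ext y
    constructor
    · rintro ⟨hy, hxy⟩
      exact ⟨hstay S hSX t x y hx hxy, hy⟩
    · rintro ⟨hy, hyS⟩
      exact ⟨hyS, hlinkS t x hx hxS y (hlink t x hx y hy) y hyS (by simpa using hη)⟩
  have hclusters : clustersAt S (η + r + η) = Set.range fun t => C t ∩ (S : Set P) := by
    ext c
    constructor
    · rintro ⟨x, hx, rfl⟩
      obtain ⟨t, ht⟩ := hcover x (hSX hx)
      exact ⟨t, (hcl t x ht hx).symm⟩
    · rintro ⟨t, rfl⟩
      obtain ⟨x, hx⟩ := hne t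
      obtain ⟨s, hsS, hst, -⟩ := hS t x hx
      exact ⟨s, hsS, (hcl t s hst hsS).symm⟩
  have hinj : Function.Injective fun t => C t ∩ (S : Set P) := by
    intro i j hij
    by_contra hne'
    obtain ⟨x, hx⟩ := hne i
    obtain ⟨s, hsS, hsi, -⟩ := hS i x hx
    have hsj : s ∈ C j ∩ (S : Set P) := by
      rw [← show C i ∩ (S : Set P) = C j ∩ S from hij]
      exact ⟨hsi, hsS⟩
    have := hsep i j hne' s hsi s hsj.1
    rw [dist_self] at this
    linarith
  refine ⟨?_, hinj⟩
  rw [SLClusters_eq_clustersAt (D := η + r + η) (by linarith) ?_, hclusters]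
  rw [hclusters, ← Set.image_univ, Set.ncard_image_of_injective _ hinj]
  simp

section Clusters

variable {k : ℕ} {C : Fin k → Set P} {D : ℝ}

lemma cluster_eq_of_mem (hC : Set.range C = clustersAt X D) {t : Fin k} {x : P} (hx : x ∈ C t) :
    C t = {y | y ∈ X ∧ SLLinked X D x y} := by
  obtain ⟨z, hz, he⟩ : C t ∈ clustersAt X D := hC ▸ Set.mem_range_self t
  rw [he] at hx ⊢
  ext y
  exact and_congr_right fun _ => ⟨hx.2.symm.trans, hx.2.trans⟩

lemma cluster_nonempty (hC : Set.range C = clustersAt X D) (t : Fin k) : (C t).Nonempty := by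
  obtain ⟨z, hz, he⟩ : C t ∈ clustersAt X D := hC ▸ Set.mem_range_self t
  rw [he]
  exact ⟨z, hz, Relation.ReflTransGen.refl⟩

lemma cluster_subset (hC : Set.range C = clustersAt X D) (t : Fin k) : C t ⊆ X := by
  obtain ⟨z, hz, he⟩ : C t ∈ clustersAt X D := hC ▸ Set.mem_range_self t
  rw [he]
  exact fun y hy => hy.1

lemma exists_mem_cluster (hC : Set.range C = clustersAt X D) {x : P} (hx : x ∈ X) :
    ∃ t, x ∈ C t := by
  obtain ⟨t, ht⟩ : {y | y ∈ X ∧ SLLinked X D x y} ∈ Set.range C := hC ▸ ⟨x, hx, rfl⟩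
  exact ⟨t, by rw [ht]; exact ⟨hx, Relation.ReflTransGen.refl⟩⟩

/-- The largest bottleneck diameter of a cluster. -/
def intraDist (X : Finset P) (C : Fin k → Set P) : ℝ :=
  sSup { r | ∃ t : Fin k, r = minMaxSet X (C t) }

/-- The smallest bottleneck diameter of a union of two clusters. -/
def interDist (X : Finset P) (C : Fin k → Set P) : ℝ :=
  sInf { r | ∃ i j : Fin k, i ≠ j ∧ r = minMaxSet X (C i ∪ C j) }

lemma intraDist_nonneg : 0 ≤ intraDist X C := by
  refine Real.sSup_nonneg ?_
  rintro _ ⟨t, rfl⟩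
  exact minMaxSet_nonneg _

lemma minMaxSet_le_intraDist (t : Fin k) : minMaxSet X (C t) ≤ intraDist X C := by
  refine le_csSup (Set.Finite.bddAbove ?_) ⟨t, rfl⟩
  refine (Set.finite_range fun t => minMaxSet X (C t)).subset ?_
  rintro _ ⟨t, rfl⟩
  exact ⟨t, rfl⟩

lemma slLinked_intraDist (hC : Set.range C = clustersAt X D) (t : Fin k) {x y : P} (hx : x ∈ C t)
    (hy : y ∈ C t) : SLLinked X (intraDist X C) x y :=
  (minMaxSet_le_iff intraDist_nonneg (cluster_subset hC t) (cluster_nonempty hC t)).1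
    (minMaxSet_le_intraDist t) x hx y hy

lemma intraDist_le (hC : Set.range C = clustersAt X D) (hD : 0 ≤ D) : intraDist X C ≤ D := by
  refine Real.sSup_le ?_ hD
  rintro _ ⟨t, rfl⟩
  refine (minMaxSet_le_iff hD (cluster_subset hC t) (cluster_nonempty hC t)).2 ?_
  intro x hx y hy
  rw [cluster_eq_of_mem hC hx] at hy
  exact hy.2

lemma finite_interDist_values :
    { r | ∃ i j : Fin k, i ≠ j ∧ r = minMaxSet X (C i ∪ C j) }.Finite := by
  refine (Set.finite_range fun p : Fin k × Fin k => minMaxSet X (C p.1 ∪ C p.2)).subset ?_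
  rintro _ ⟨i, j, -, rfl⟩
  exact ⟨(i, j), rfl⟩

lemma lt_interDist (hC : Set.range C = clustersAt X D) (hD : 0 ≤ D) (hinj : Function.Injective C)
    (hk : 2 ≤ k) : D < interDist X C := by
  obtain ⟨i, j, hij, he⟩ := Set.Nonempty.csInf_mem
    (s := { r | ∃ i j : Fin k, i ≠ j ∧ r = minMaxSet X (C i ∪ C j) })
    ⟨_, ⟨0, by omega⟩, ⟨1, by omega⟩, by simp, rfl⟩ finite_interDist_values
  rw [interDist, he]
  by_contra! hle
  obtain ⟨x, hx⟩ := cluster_nonempty hC i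
  obtain ⟨y, hy⟩ := cluster_nonempty hC j
  have hlink := (minMaxSet_le_iff hD
    (Set.union_subset (cluster_subset hC i) (cluster_subset hC j)) ⟨x, Or.inl hx⟩).1 hle
    x (Or.inl hx) y (Or.inr hy)
  have hyi : y ∈ C i := by
    rw [cluster_eq_of_mem hC hx]
    exact ⟨cluster_subset hC j hy, hlink⟩
  refine hij (hinj ?_)
  rw [cluster_eq_of_mem hC hyi, cluster_eq_of_mem hC hy]

lemma interDist_le_dist (hC : Set.range C = clustersAt X D) (hD : 0 ≤ D)
    (hinj : Function.Injective C) (hk : 2 ≤ k) {i j : Fin k} (hij : i ≠ j) {x y : P}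
    (hx : x ∈ C i) (hy : y ∈ C j) : interDist X C ≤ dist x y := by
  by_contra! hlt
  have hrR : intraDist X C < interDist X C :=
    (intraDist_le hC hD).trans_lt (lt_interDist hC hD hinj hk)
  set E := max (intraDist X C) (dist x y) with hE
  have hER : E < interDist X C := max_lt hrR hlt
  have hE0 : 0 ≤ E := le_max_of_le_left intraDist_nonneg
  have hXij := Set.union_subset (cluster_subset hC i) (cluster_subset hC j)
  have hto : ∀ z ∈ C i ∪ C j, SLLinked X E z x := by
    rintro z (hz | hz)
    · exact (slLinked_intraDist hC i hz hx).mono (le_max_left _ _)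
    · refine ((slLinked_intraDist hC j hz hy).mono (le_max_left _ _)).trans ?_
      refine SLLinked.of_dist_le (hXij (Or.inr hy)) (hXij (Or.inl hx)) ?_
      rw [dist_comm]
      exact le_max_right _ _
  have hle : minMaxSet X (C i ∪ C j) ≤ E :=
    (minMaxSet_le_iff hE0 hXij ⟨x, Or.inl hx⟩).2 fun a ha b hb => (hto a ha).trans (hto b hb).symm
  have : interDist X C ≤ minMaxSet X (C i ∪ C j) :=
    csInf_le finite_interDist_values.bddBelow ⟨i, j, hij, rfl⟩
  linarith

end Clusters

end Linkage

/-! ### Windows of nearby points inside the clusters -/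

section Windows

variable {P : Type*} [MetricSpace P] {X : Finset P} {k : ℕ} {C : Fin k → Set P} {D : ℝ}

lemma zetaSL_eq : zetaSL X C = (X.card : ℝ) *
    ((⌈(interDist X C - intraDist X C) / intraDist X C⌉ : ℝ))⁻¹ := rfl

lemma zetaSL_nonneg (h : intraDist X C ≤ interDist X C) : 0 ≤ zetaSL X C := by
  have : 0 ≤ ⌈(interDist X C - intraDist X C) / intraDist X C⌉ :=
    Int.ceil_nonneg (div_nonneg (by linarith) intraDist_nonneg)
  have : (0 : ℝ) ≤ ⌈(interDist X C - intraDist X C) / intraDist X C⌉ := by exact_mod_cast this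
  rw [zetaSL_eq]
  positivity

lemma iInf_ncard_le {P : Type*} {k : ℕ} {C : Fin k → Set P} (t : Fin k) : (⨅ i, ((C i).ncard : ℝ)) ≤ (C t).ncard :=
  ciInf_le (Set.finite_range _).bddBelow t

lemma one_le_iInf_ncard (hC : Set.range C = clustersAt X D) (hk : 0 < k) :
    1 ≤ ⨅ i, ((C i).ncard : ℝ) := by
  have : Nonempty (Fin k) := ⟨⟨0, hk⟩⟩
  refine le_ciInf fun t => ?_
  have := (Set.ncard_pos (X.finite_toSet.subset (cluster_subset hC t))).2 (cluster_nonempty hC t)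
  exact_mod_cast this

lemma exists_window_size (hC : Set.range C = clustersAt X D) (hk : 0 < k)
    (hlt : intraDist X C < interDist X C) :
    ∃ N : ℕ, 1 ≤ N ∧
      ((N : ℝ) - 1) * intraDist X C + intraDist X C + ((N : ℝ) - 1) * intraDist X C <
        interDist X C ∧
      ∀ t, (X.card : ℝ) / 2 ≤ (min N (C t).ncard : ℕ) *
        ((X.card : ℝ) / (⨅ i, ((C i).ncard : ℝ)) + zetaSL X C) := by
  have hκ := one_le_iInf_ncard hC hk
  have hζ := zetaSL_nonneg hlt.le
  have hκt := fun t => iInf_ncard_le (C := C) t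
  set κ := ⨅ i, ((C i).ncard : ℝ)
  have hn : (0 : ℝ) ≤ X.card := Nat.cast_nonneg _
  have hwhole : ∀ t, (X.card : ℝ) / 2 ≤ (C t).ncard * ((X.card : ℝ) / κ + zetaSL X C) := by
    intro t
    calc (X.card : ℝ) / 2 ≤ κ * (X.card / κ) := by
          rw [mul_div_cancel₀ _ (by linarith)]; linarith
      _ ≤ (C t).ncard * ((X.card : ℝ) / κ + zetaSL X C) := by
          gcongr
          · exact hκt t
          · linarith
  rcases intraDist_nonneg (X := X) (C := C).eq_or_lt with h0 | hpos
  · refine ⟨X.card, ?_, ?_, fun t => ?_⟩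
    · obtain ⟨x, hx⟩ := cluster_nonempty hC ⟨0, hk⟩
      exact Finset.card_pos.2 ⟨x, cluster_subset hC _ hx⟩
    · rw [← h0] at hlt ⊢
      simpa using hlt
    · have : (C t).ncard ≤ X.card := by
        rw [← Set.ncard_coe_finset]
        exact Set.ncard_le_ncard (cluster_subset hC t) X.finite_toSet
      rw [min_eq_right this]
      exact hwhole t
  · set r := intraDist X C with hr
    set R := interDist X C with hR
    set z := ⌈(R - r) / r⌉ with hz
    have hz1 : 1 ≤ z := Int.one_le_ceil_iff.2 (div_pos (by linarith) hpos)
    have hzR : z * r < R := by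
      have := Int.ceil_lt_add_one ((R - r) / r)
      rw [← hz] at this
      have h2 : (R - r) / r + 1 = R / r := by field_simp; ring
      rw [← lt_div_iff₀ hpos]
      linarith
    obtain ⟨N, hN⟩ : ∃ N : ℕ, (N : ℤ) = (z + 1) / 2 :=
      ⟨((z + 1) / 2).toNat, Int.toNat_of_nonneg (by omega)⟩
    have hN1 : 1 ≤ N := by omega
    have hNz : 2 * (N : ℝ) - 1 ≤ z := by
      have : 2 * (N : ℤ) - 1 ≤ z := by omega
      exact_mod_cast this
    have hzN : (z : ℝ) ≤ 2 * N := by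
      have : z ≤ 2 * (N : ℤ) := by omega
      exact_mod_cast this
    refine ⟨N, hN1, by nlinarith, fun t => ?_⟩
    rcases le_total N (C t).ncard with h | h
    · rw [min_eq_left h]
      have hzpos : (0 : ℝ) < z := by exact_mod_cast hz1
      have : 0 ≤ (X.card : ℝ) / κ := by positivity
      calc (X.card : ℝ) / 2 = z / 2 * (X.card * (z : ℝ)⁻¹) := by field_simp
        _ ≤ N * ((X.card : ℝ) / κ + zetaSL X C) := by
          have e : zetaSL X C = X.card * (z : ℝ)⁻¹ := rfl
          rw [← e]
          gcongr
          · linarith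
          · linarith
    · rw [min_eq_right h]
      exact hwhole t

lemma exists_windows (hC : Set.range C = clustersAt X D) (hk : 0 < k)
    (hle : intraDist X C ≤ D) (hlt : intraDist X C < interDist X C) :
    ∃ η : ℝ, 0 ≤ η ∧ η + intraDist X C + η < interDist X C ∧
      ∀ x : {x // x ∈ X}, ∃ A : Finset {x // x ∈ X},
        (X.card : ℝ) / 2 ≤ A.card *
          ((X.card : ℝ) / (⨅ i, ((C i).ncard : ℝ)) + zetaSL X C) ∧
        ∀ a ∈ A, ∀ t, (x : P) ∈ C t → (a : P) ∈ C t ∧ dist (x : P) a ≤ η := by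
  obtain ⟨N, hN1, hNR, hcard⟩ := exists_window_size hC hk hlt
  have hr0 := intraDist_nonneg (X := X) (C := C)
  have hN1' : (1 : ℝ) ≤ N := by exact_mod_cast hN1
  refine ⟨((N : ℝ) - 1) * intraDist X C, mul_nonneg (by linarith) hr0, hNR, ?_⟩
  rintro ⟨x, hx⟩
  obtain ⟨t, ht⟩ := exists_mem_cluster hC hx
  have hstay : ∀ y, SLLinked X (intraDist X C) x y → y ∈ C t := by
    intro y hxy
    rw [cluster_eq_of_mem hC ht]
    exact ⟨hxy.mem hx, hxy.mono hle⟩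
  set K := X.filter fun y => y ∈ C t with hK
  have hKC : (K : Set P) = C t := by
    ext y
    simp only [hK, Finset.coe_filter, Set.mem_ofPred_eq, and_iff_right_iff_imp]
    exact fun hy => cluster_subset hC t hy
  have hKcard : K.card = (C t).ncard := by rw [← hKC, Set.ncard_coe_finset]
  have hpos : 1 ≤ K.card := Finset.card_pos.2 ⟨x, Finset.mem_filter.2 ⟨hx, ht⟩⟩
  obtain ⟨A, hAK, -, hAN, hAd⟩ := exists_near_subset hr0 (x := x) (K := K) (N := min N K.card)
    (fun y => by
      rw [hK, Finset.mem_filter]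
      exact ⟨fun h => slLinked_intraDist hC t ht h.2, fun h => ⟨h.mem hx, hstay y h⟩⟩)
    (le_min hN1 hpos) (min_le_right _ _)
  refine ⟨A.subtype (· ∈ X), ?_, ?_⟩
  · rw [Finset.card_subtype, Finset.filter_true_of_mem, hAN, hKcard]
    · exact hcard t
    · exact fun a ha => (Finset.mem_filter.1 (hAK ha)).1
  · intro a ha j hj
    rw [Finset.mem_subtype] at ha
    refine ⟨?_, (hAd a ha).trans ?_⟩
    · have haC : (a : P) ∈ C t := (Finset.mem_filter.1 (hAK ha)).2
      rw [cluster_eq_of_mem hC hj]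
      rw [cluster_eq_of_mem hC ht] at haC
      exact haC
    · have : ((min N K.card : ℕ) : ℝ) ≤ N := by exact_mod_cast min_le_left _ _
      gcongr

end Windows

/-! ### Clustering cost -/

section Cost

variable {P : Type*} {X : Finset P} {k : ℕ} {Gt : Fin k → Set P}

lemma costSet_nonneg (S : Finset P) (C : Set (Set P)) : 0 ≤ costSet S C Gt := by
  refine mul_nonneg (by positivity) (Real.sInf_nonneg ?_)
  rintro _ ⟨f, -, -, σ, rfl⟩
  positivity

lemma costSet_le_one (S : Finset P) (C : Set (Set P)) : costSet S C Gt ≤ 1 := by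
  have h : sInf { c : ℝ | ∃ f : Fin k → Set P, Function.Injective f ∧ Set.range f = C ∧
      ∃ σ : Equiv.Perm (Fin k),
        c = ({ x ∈ (S : Set P) | ∃ j, x ∈ f (σ j) ∧ x ∉ Gt j }.ncard : ℝ) } ≤ S.card := by
    rcases Set.eq_empty_or_nonempty { c : ℝ | ∃ f : Fin k → Set P, Function.Injective f ∧
      Set.range f = C ∧ ∃ σ : Equiv.Perm (Fin k),
        c = ({ x ∈ (S : Set P) | ∃ j, x ∈ f (σ j) ∧ x ∉ Gt j }.ncard : ℝ) } with h | ⟨c, hc⟩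
    · rw [h, Real.sInf_empty]; positivity
    · refine (csInf_le ⟨0, ?_⟩ hc).trans ?_
      · rintro _ ⟨f, -, -, σ, rfl⟩
        positivity
      · obtain ⟨f, -, -, σ, rfl⟩ := hc
        have := Set.ncard_le_ncard
          (Set.sep_subset (S : Set P) fun x => ∃ j, x ∈ f (σ j) ∧ x ∉ Gt j) S.finite_toSet
        rw [Set.ncard_coe_finset] at this
        exact_mod_cast this
  calc costSet S C Gt ≤ (S.card : ℝ)⁻¹ * S.card := mul_le_mul_of_nonneg_left h (by positivity)
    _ ≤ 1 := inv_mul_le_one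

lemma costSet_eq_zero_of_one {Gt : Fin 1 → Set P} (hG : IsGroundTruth X Gt) {S : Finset P}
    (hS : S ⊆ X) (C : Set (Set P)) : costSet S C Gt = 0 := by
  have hGX : ∀ j, Gt j = X := by
    intro j
    rw [← hG.2.2, Subsingleton.elim j 0]
    ext; simp
  have hsub : { c : ℝ | ∃ f : Fin 1 → Set P, Function.Injective f ∧ Set.range f = C ∧
      ∃ σ : Equiv.Perm (Fin 1),
        c = ({ x ∈ (S : Set P) | ∃ j, x ∈ f (σ j) ∧ x ∉ Gt j }.ncard : ℝ) } ⊆ {0} := by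
    rintro _ ⟨f, -, -, σ, rfl⟩
    have : { x ∈ (S : Set P) | ∃ j, x ∈ f (σ j) ∧ x ∉ Gt j } = ∅ := by
      ext x
      simp only [hGX, Set.mem_ofPred_eq, Set.mem_empty_iff_false, iff_false]
      rintro ⟨hx, j, -, hj⟩
      exact hj (hS hx)
    rw [Set.mem_singleton_iff, this, Set.ncard_empty, Nat.cast_zero]
  rcases Set.subset_singleton_iff_eq.1 hsub with h | h
  · rw [costSet, h, Real.sInf_empty, mul_zero]
  · rw [costSet, h, csInf_singleton, mul_zero]

/-- The cost of an enumerated clustering is a minimum over relabellings. -/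
lemma costSet_range {C : Fin k → Set P} (hC : Function.Injective C) (S : Finset P) :
    costSet S (Set.range C) Gt = ⨅ τ : Equiv.Perm (Fin k),
      (S.card : ℝ)⁻¹ * ({ x ∈ (S : Set P) | ∃ j, x ∈ C (τ j) ∧ x ∉ Gt j }.ncard : ℝ) := by
  rw [← Real.mul_iInf_of_nonneg (by positivity), costSet, iInf]
  congr 2
  ext c
  constructor
  · rintro ⟨f, hf, hfC, σ, rfl⟩
    have hg : ∀ j, ∃ i, C i = f (σ j) := fun j => by
      have : f (σ j) ∈ Set.range C := hfC ▸ Set.mem_range_self _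
      exact this
    choose g hg using hg
    have hginj : Function.Injective g := fun a b hab =>
      σ.injective (hf (by rw [← hg a, ← hg b, hab]))
    refine ⟨Equiv.ofBijective g (Finite.injective_iff_bijective.1 hginj), ?_⟩
    simp [hg]
  · rintro ⟨τ, rfl⟩
    exact ⟨C, hC, rfl, τ, rfl⟩

lemma abs_iInf_sub_iInf_le {ι : Type*} [Finite ι] [Nonempty ι] {a b : ι → ℝ} {ε : ℝ}
    (h : ∀ i, |a i - b i| ≤ ε) : |(⨅ i, a i) - ⨅ i, b i| ≤ ε := by
  have key : ∀ a b : ι → ℝ, (∀ i, |a i - b i| ≤ ε) → (⨅ i, a i) - ε ≤ ⨅ i, b i := by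
    intro a b h
    refine le_ciInf fun i => ?_
    have h1 := ciInf_le (Set.finite_range a).bddBelow i
    have h2 := le_of_abs_le (h i)
    linarith
  have h1 := key a b h
  have h2 := key b a fun i => by rw [abs_sub_comm]; exact h i
  rw [abs_le]
  constructor <;> linarith

lemma sampleFinset_subset {m : ℕ} (ω : Fin m → {x // x ∈ X}) : sampleFinset X ω ⊆ X := by
  intro x hx
  obtain ⟨i, -, rfl⟩ := Finset.mem_image.1 hx
  exact (ω i).2

lemma mem_sampleFinset {m : ℕ} (ω : Fin m → {x // x ∈ X}) (x : {x // x ∈ X}) :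
    (x : P) ∈ sampleFinset X ω ↔ x ∈ Set.range ω := by
  rw [sampleFinset, Finset.mem_image]
  constructor
  · rintro ⟨i, -, hi⟩
    exact ⟨i, Subtype.ext hi⟩
  · rintro ⟨i, rfl⟩
    exact ⟨i, Finset.mem_univ _, rfl⟩

lemma ncard_sep_sampleFinset {m : ℕ} (ω : Fin m → {x // x ∈ X}) (p : P → Prop) [DecidablePred p] :
    { x ∈ (sampleFinset X ω : Set P) | p x }.ncard =
      ((Finset.univ.filter fun x : {x // x ∈ X} => p x).filter fun x => x ∈ Set.range ω).card := by
  rw [← Set.ncard_coe_finset, ← Set.ncard_image_of_injective _ Subtype.val_injective]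
  congr 1
  ext x
  simp only [Set.mem_ofPred_eq, Set.mem_image, Finset.coe_filter, Finset.mem_filter,
    Finset.mem_univ, true_and]
  constructor
  · rintro ⟨hx, hp⟩
    exact ⟨⟨x, sampleFinset_subset ω hx⟩, ⟨hp, (mem_sampleFinset ω _).1 hx⟩, rfl⟩
  · rintro ⟨y, ⟨hp, hy⟩, rfl⟩
    exact ⟨(mem_sampleFinset ω y).2 hy, hp⟩

lemma ncard_sep_eq_card_filter (p : P → Prop) [DecidablePred p] :
    { x ∈ (X : Set P) | p x }.ncard =
      (Finset.univ.filter fun x : {x // x ∈ X} => p x).card := by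
  rw [← Set.ncard_coe_finset, ← Set.ncard_image_of_injective _ Subtype.val_injective]
  congr 1
  ext x
  simp [and_comm]

lemma abs_div_sub_div_le {a N b n p ε : ℝ} (hb : 0 ≤ b) (hbn : b ≤ n) (hn : 0 < n) (hp : 0 < p)
    (hε : 0 ≤ ε) (hε1 : ε ≤ 1) (ha : |a - p * b| ≤ ε * n * p / 4)
    (hN : |N - p * n| ≤ ε * n * p / 4) : |N⁻¹ * a - n⁻¹ * b| ≤ ε := by
  have hnp : 0 < n * p := mul_pos hn hp
  have hN2 : n * p / 2 ≤ N := by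
    have := (abs_le.1 hN).1
    nlinarith
  have hN0 : 0 < N := by linarith
  have e : N⁻¹ * a - n⁻¹ * b = (n * (a - p * b) - b * (N - p * n)) / (N * n) := by
    field_simp; ring
  rw [e, abs_div, abs_of_pos (mul_pos hN0 hn), div_le_iff₀ (mul_pos hN0 hn)]
  calc |n * (a - p * b) - b * (N - p * n)|
      ≤ |n * (a - p * b)| + |b * (N - p * n)| := abs_sub _ _
    _ = n * |a - p * b| + b * |N - p * n| := by
        rw [abs_mul, abs_mul, abs_of_pos hn, abs_of_nonneg hb]
    _ ≤ n * (ε * n * p / 4) + n * (ε * n * p / 4) := by gcongr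
    _ = ε * n * (n * p / 2) := by ring
    _ ≤ ε * n * N := by gcongr
    _ = ε * (N * n) := by ring

/-- The points of `X` misplaced by the clustering `C` under the labelling `τ`. -/
def misplaced (X : Finset P) (C Gt : Fin k → Set P) (τ : Equiv.Perm (Fin k)) :
    Finset {x // x ∈ X} :=
  Finset.univ.filter fun x => ∃ j, (x : P) ∈ C (τ j) ∧ (x : P) ∉ Gt j

/-- If single linkage on the sample returns the traces of the clusters and the sampled frequencies
of all misplaced sets are accurate, then so is the cost. -/
lemma abs_costSet_sub_le [MetricSpace P] {m : ℕ} {C : Fin k → Set P} (hC : Function.Injective C)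
    {ω : Fin m → {x // x ∈ X}} {p ε : ℝ} (hX : 0 < X.card) (hp : 0 < p) (hε : 0 ≤ ε)
    (hε1 : ε ≤ 1)
    (hSL : SLClusters (sampleFinset X ω) k = Set.range fun t => C t ∩ (sampleFinset X ω : Set P))
    (hinj : Function.Injective fun t => C t ∩ (sampleFinset X ω : Set P))
    (hdev : ∀ B : Option (Equiv.Perm (Fin k)),
      |((((B.elim Finset.univ (misplaced X C Gt)).filter fun x => x ∈ Set.range ω).card : ℕ) : ℝ) -
        p * (B.elim Finset.univ (misplaced X C Gt)).card| ≤ ε * X.card * p / 4) :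
    |costSet (sampleFinset X ω) (SLClusters (sampleFinset X ω) k) Gt -
      costSet X (Set.range C) Gt| ≤ ε := by
  rw [hSL, costSet_range hinj, costSet_range hC]
  refine abs_iInf_sub_iInf_le fun τ => ?_
  have hcardS : (sampleFinset X ω).card =
      ((Finset.univ : Finset {x // x ∈ X}).filter fun x => x ∈ Set.range ω).card := by
    have := ncard_sep_sampleFinset ω fun _ => True
    simpa only [and_true, Set.ofPred_mem_eq, Set.ncard_coe_finset, Finset.filter_true] using this
  have hbadS : { x ∈ (sampleFinset X ω : Set P) |
      ∃ j, x ∈ C (τ j) ∩ (sampleFinset X ω : Set P) ∧ x ∉ Gt j }.ncard =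
      ((misplaced X C Gt τ).filter fun x => x ∈ Set.range ω).card := by
    rw [misplaced, ← ncard_sep_sampleFinset ω fun x => ∃ j, x ∈ C (τ j) ∧ x ∉ Gt j]
    congr 1
    ext x
    simp only [Set.mem_ofPred_eq, Set.mem_inter_iff]
    exact and_congr_right fun hx => exists_congr fun j => by simp [Finset.mem_coe.1 hx]
  have hbad : { x ∈ (X : Set P) | ∃ j, x ∈ C (τ j) ∧ x ∉ Gt j }.ncard =
      (misplaced X C Gt τ).card := ncard_sep_eq_card_filter _
  have h1 := hdev (some τ)
  have h2 := hdev none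
  simp only [Option.elim] at h1 h2
  rw [Finset.card_univ, Fintype.card_coe] at h2
  rw [hbadS, hbad, hcardS]
  refine abs_div_sub_div_le (by positivity) ?_ (by exact_mod_cast hX) hp hε hε1 h1 h2
  have := Finset.card_le_univ (misplaced X C Gt τ)
  rw [Fintype.card_coe] at this
  exact_mod_cast this

end Cost

/-! ### The failure probabilities -/

lemma factorial_bound {n k : ℕ} (hk : 2 ≤ k) (hkn : k ≤ n) {δ : ℝ} (hδ : 0 < δ) (hδ1 : δ < 1) :
    ((k.factorial : ℝ) + 1) * (2 * exp (-(3 * k * log ((n : ℝ) * k / δ)))) ≤ δ / 2 := by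
  have hk' : (2 : ℝ) ≤ k := by exact_mod_cast hk
  have hkn' : (k : ℝ) ≤ n := by exact_mod_cast hkn
  set w : ℝ := δ / (n * k) with hw
  have hnk : (4 : ℝ) ≤ n * k := by nlinarith
  have hw0 : 0 < w := by positivity
  have hwδ : w ≤ δ / 4 := by rw [hw]; gcongr
  have e : exp (-(3 * k * log ((n : ℝ) * k / δ))) = w ^ k * w ^ (2 * k) := by
    rw [← pow_add, show k + 2 * k = 3 * k by ring, ← exp_log hw0, ← exp_nat_mul]
    have : log w = -log ((n : ℝ) * k / δ) := by
      rw [← log_inv, inv_div]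
    rw [this]
    congr 1; push_cast; ring
  have hkw : (k : ℝ) ^ k * w ^ k ≤ 1 := by
    rw [← mul_pow]
    refine pow_le_one₀ (by positivity) ?_
    have : (k : ℝ) * w = δ / n := by rw [hw]; field_simp
    rw [this, div_le_one (by linarith)]
    linarith
  have hw2 : w ^ (2 * k) ≤ w ^ 2 := pow_le_pow_of_le_one hw0.le (by linarith) (by omega)
  have hfac : (k.factorial : ℝ) ≤ (k : ℝ) ^ k := by exact_mod_cast Nat.factorial_le_pow k
  have h1k : (1 : ℝ) ≤ (k : ℝ) ^ k := one_le_pow₀ (by linarith)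
  rw [e]
  calc ((k.factorial : ℝ) + 1) * (2 * (w ^ k * w ^ (2 * k)))
      ≤ ((k : ℝ) ^ k + (k : ℝ) ^ k) * (2 * (w ^ k * w ^ 2)) := by gcongr
    _ = 4 * ((k : ℝ) ^ k * w ^ k) * w ^ 2 := by ring
    _ ≤ 4 * 1 * w ^ 2 := by gcongr
    _ ≤ δ / 2 := by nlinarith


lemma exp_neg_window_le {n k a m w δ : ℝ} (hn : 0 < n) (hk : 0 < k) (hδ : 0 < δ) (ha : 0 ≤ a)
    (hT : 0 ≤ log (n * k / δ)) (haw : n / 2 ≤ a * w) (hm : 1000 * w * log (n * k / δ) ≤ m) :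
    exp (-(m * a / n)) ≤ δ / (n * k) := by
  have h : log (n * k / δ) ≤ m * a / n := by
    rw [le_div_iff₀ hn]
    calc log (n * k / δ) * n ≤ 1000 * log (n * k / δ) * (n / 2) := by
          nlinarith [mul_nonneg hT hn.le]
      _ ≤ 1000 * log (n * k / δ) * (a * w) := by gcongr
      _ = 1000 * w * log (n * k / δ) * a := by ring
      _ ≤ m * a := by gcongr
  calc exp (-(m * a / n)) ≤ exp (-log (n * k / δ)) := exp_le_exp.2 (by linarith)
    _ = δ / (n * k) := by rw [exp_neg, exp_log (by positivity), inv_div]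

lemma unifProb_exists_avoid_le {α : Type*} [Fintype α] [Nonempty α] {m : ℕ} (A : α → Finset α)
    {k w δ : ℝ} (hk : 2 ≤ k) (hδ : 0 < δ) (hT : 0 ≤ log (Fintype.card α * k / δ))
    (hA : ∀ x, (Fintype.card α : ℝ) / 2 ≤ (A x).card * w)
    (hm : 1000 * w * log (Fintype.card α * k / δ) ≤ m) :
    unifProb {ω : Fin m → α | ∃ x, ∀ i, ω i ∉ A x} ≤ δ / 2 := by
  have hn : (0 : ℝ) < Fintype.card α := by positivity
  have h := unifProb_exists_le Finset.univ fun x => {ω : Fin m → α | ∀ i, ω i ∉ A x}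
  simp only [Finset.mem_univ, true_and, Set.mem_ofPred_eq] at h
  refine h.trans ((Finset.sum_le_sum fun x _ => (unifProb_avoid_le (A x)).trans
    (exp_neg_window_le hn (by linarith) hδ (Nat.cast_nonneg _) hT (hA x) hm)).trans ?_)
  rw [Finset.sum_const, Finset.card_univ, nsmul_eq_mul]
  have : (Fintype.card α : ℝ) * (δ / (Fintype.card α * k)) = δ / k := by field_simp
  rw [this]
  gcongr

lemma unifProb_exists_deviation_le {α : Type*} [Fintype α] [Nonempty α] {m k : ℕ}
    (B : Option (Equiv.Perm (Fin k)) → Finset α) {ε δ : ℝ} (hk : 2 ≤ k)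
    (hkn : k ≤ Fintype.card α) (hε : 0 < ε) (hε1 : ε ≤ 1) (hδ : 0 < δ) (hδ1 : δ < 1)
    (hT : 0 ≤ log ((Fintype.card α : ℝ) * k / δ))
    (hm : 1000 * (k / ε ^ 2) * log ((Fintype.card α : ℝ) * k / δ) ≤ m) :
    unifProb {ω : Fin m → α | ∃ b,
        ε * Fintype.card α * (1 - missProb (Fintype.card α) m) / 4 <
          |(((B b).filter fun x => x ∈ Set.range ω).card : ℝ) -
            (1 - missProb (Fintype.card α) m) * (B b).card|} ≤ δ / 2 := by
  have h := unifProb_exists_le Finset.univ fun b => {ω : Fin m → α |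
        ε * Fintype.card α * (1 - missProb (Fintype.card α) m) / 4 <
          |(((B b).filter fun x => x ∈ Set.range ω).card : ℝ) -
            (1 - missProb (Fintype.card α) m) * (B b).card|}
  simp only [Finset.mem_univ, true_and, Set.mem_ofPred_eq] at h
  refine h.trans ((Finset.sum_le_sum fun b _ =>
    unifProb_abs_hit_deviation_le (B b) hε hε1).trans ?_)
  rw [Finset.sum_const, Finset.card_univ, Fintype.card_option, Fintype.card_perm,
    Fintype.card_fin, nsmul_eq_mul]
  refine le_trans ?_ (factorial_bound hk hkn hδ hδ1)
  push_cast
  gcongr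
  set T := log ((Fintype.card α : ℝ) * k / δ)
  have h1 : ε ^ 2 * (1000 * (k / ε ^ 2) * T) ≤ ε ^ 2 * m := by gcongr
  have h2 : ε ^ 2 * (1000 * (k / ε ^ 2) * T) = 1000 * (k * T) := by field_simp
  have h3 : 0 ≤ k * T := by positivity
  linarith
/-- Size generalization for single linkage: there is a universal constant
`c > 0` such that if `m ≥ c·((k/ε²) + n/min_i |C_i| + ζ_{k,SL}(X))·log(nk/δ)`, then with
probability at least `1 − δ` over a subsample `X_m` of `m` points drawn uniformly with
replacement from `X`, `|cost(SingleLinkage(X_m,k);G) − cost(SingleLinkage(X,k);G)| ≤ ε`. -/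
theorem stmt4 :
    ∃ c : ℝ, 0 < c ∧
      ∀ (d n k m : ℕ) (X : Finset (EuclideanSpace ℝ (Fin d))), X.card = n → 0 < k →
        ∀ Gt : Fin k → Set (EuclideanSpace ℝ (Fin d)), IsGroundTruth X Gt →
          ∀ C : Fin k → Set (EuclideanSpace ℝ (Fin d)), Function.Injective C →
            IsSLClustering X k (Set.range C) →
            ∀ ε δ : ℝ, 0 < ε → 0 < δ → δ < 1 →
              c * ((k / ε ^ 2) + (n : ℝ) / (⨅ i, ((C i).ncard : ℝ)) + zetaSL X C) *
                  Real.log ((n : ℝ) * k / δ) ≤ m →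
              1 - δ ≤ unifProb { ω : Fin m → {x // x ∈ X} |
                  |costSet (sampleFinset X ω) (SLClusters (sampleFinset X ω) k) Gt -
                    costSet X (Set.range C) Gt| ≤ ε } := by
  refine ⟨1000, by norm_num, ?_⟩
  intro d n k m X hXn hk Gt hG C hCinj hSL ε δ hε hδ hδ1 hm
  subst hXn
  obtain ⟨l, hC, hcardC⟩ := hSL
  have hD := mergeDist_nonneg X l
  set D := mergeDist X l
  obtain ⟨x₀, hx₀⟩ := cluster_nonempty hC ⟨0, hk⟩
  have hx₀X : x₀ ∈ X := cluster_subset hC _ hx₀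
  have : Nonempty {x // x ∈ X} := ⟨⟨x₀, hx₀X⟩⟩
  have hXpos : 0 < X.card := Finset.card_pos.2 ⟨x₀, hx₀X⟩
  rw [← one_sub_unifProb_compl]
  refine sub_le_sub_left ?_ 1
  rcases Nat.lt_or_ge k 2 with hk1 | hk2
  · obtain rfl : k = 1 := by omega
    refine le_trans (le_of_eq ?_) hδ.le
    rw [unifProb_eq_ncard]
    have : {ω : Fin m → {x // x ∈ X} |
        |costSet (sampleFinset X ω) (SLClusters (sampleFinset X ω) 1) Gt -
          costSet X (Set.range C) Gt| ≤ ε} = Set.univ := by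
      ext ω
      simp [costSet_eq_zero_of_one hG (sampleFinset_subset ω),
        costSet_eq_zero_of_one hG (Finset.Subset.refl X), hε.le]
    simp [this]
  rcases le_total 1 ε with hε1 | hε1
  · refine le_trans (le_of_eq ?_) hδ.le
    rw [unifProb_eq_ncard]
    have : {ω : Fin m → {x // x ∈ X} |
        |costSet (sampleFinset X ω) (SLClusters (sampleFinset X ω) k) Gt -
          costSet X (Set.range C) Gt| ≤ ε} = Set.univ := by
      refine Set.eq_univ_of_forall fun ω => (abs_sub_le_of_nonneg_of_le (costSet_nonneg _ _)
        (costSet_le_one _ _) (costSet_nonneg _ _) (costSet_le_one _ _)).trans hε1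
    simp [this]
  have hkX : k ≤ X.card := by
    have h := Set.ncard_image_of_injective Set.univ hCinj
    rw [Set.image_univ, hC, clustersAt_eq_image, Set.ncard_univ, Nat.card_eq_fintype_card,
      Fintype.card_fin] at h
    rw [← h, ← Set.ncard_coe_finset X]
    exact Set.ncard_image_le X.finite_toSet
  have hlt : intraDist X C < interDist X C :=
    (intraDist_le hC hD).trans_lt (lt_interDist hC hD hCinj hk2)
  obtain ⟨η, hη, hηR, hwin⟩ := exists_windows hC hk (intraDist_le hC hD) hlt
  choose A hAcard hA using hwin
  have hζ := zetaSL_nonneg hlt.le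
  have hκ := one_le_iInf_ncard hC hk
  set κ := ⨅ i, ((C i).ncard : ℝ)
  have hcard : Fintype.card {x // x ∈ X} = X.card := Fintype.card_coe X
  have hn0 : (0 : ℝ) < X.card := by exact_mod_cast hXpos
  have hk2' : (2 : ℝ) ≤ k := by exact_mod_cast hk2
  have hkX' : (k : ℝ) ≤ X.card := by exact_mod_cast hkX
  set T := log ((X.card : ℝ) * k / δ) with hT
  have hT0 : 0 < T := by
    refine log_pos ?_
    rw [lt_div_iff₀ hδ]
    nlinarith
  have hwκ : 0 ≤ (X.card : ℝ) / κ + zetaSL X C := by positivity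
  have hm1 : 1000 * (k / ε ^ 2) * T ≤ m := by
    refine le_trans ?_ hm
    gcongr
    linarith
  have hm2 : 1000 * ((X.card : ℝ) / κ + zetaSL X C) * T ≤ m := by
    refine le_trans ?_ hm
    have : 0 ≤ k / ε ^ 2 := by positivity
    gcongr
    linarith
  have hmpos : (0 : ℝ) < m := lt_of_lt_of_le (by positivity) hm1
  have hp : 0 < 1 - missProb X.card m := by
    have h := half_div_le_max_mul_hitProb hXpos m
    have h2 : 0 < (m : ℝ) / X.card / 2 := by positivity
    exact pos_of_mul_pos_right (h2.trans_le h) (le_max_of_le_left zero_le_one)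
  have hmissed := unifProb_exists_avoid_le (m := m) A hk2' hδ
    (by rw [hcard]; exact hT0.le) (by rw [hcard]; exact hAcard) (by rw [hcard]; exact hm2)
  have hdeviant := unifProb_exists_deviation_le (m := m)
    (fun B => B.elim Finset.univ (misplaced X C Gt)) hk2 (hkX.trans hcard.ge) hε hε1 hδ hδ1
    (by rw [hcard]; exact hT0.le) (by rw [hcard]; exact hm1)
  refine (unifProb_mono ?_).trans ((unifProb_union_le _ _).trans
    ((add_le_add hmissed hdeviant).trans_eq (add_halves δ)))
  intro ω hω
  by_contra hgood
  rw [Set.mem_union, not_or] at hgood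
  obtain ⟨hhit, hdev⟩ := hgood
  refine hω ?_
  have hrep : ∀ t, ∀ x ∈ C t, ∃ s ∈ sampleFinset X ω, s ∈ C t ∧ dist x s ≤ η := by
    intro t x hx
    have hxX : x ∈ X := cluster_subset hC t hx
    obtain ⟨i, hi⟩ : ∃ i, ω i ∈ A ⟨x, hxX⟩ := by
      by_contra! hno
      exact hhit ⟨⟨x, hxX⟩, hno⟩
    obtain ⟨h1, h2⟩ := hA _ _ hi t hx
    exact ⟨ω i, (mem_sampleFinset ω _).2 ⟨i, rfl⟩, h1, h2⟩
  obtain ⟨hSL, hinj⟩ := SLClusters_subsample intraDist_nonneg hη hηR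
    (fun x hx => exists_mem_cluster hC hx) (cluster_nonempty hC)
    (fun t x hx y hy => slLinked_intraDist hC t hx hy)
    (fun i j hij x hx y hy => interDist_le_dist hC hD hCinj hk2 hij hx hy)
    (sampleFinset_subset ω) hrep
  refine abs_costSet_sub_le hCinj hXpos hp hε.le hε1 hSL hinj fun B => ?_
  refine not_lt.1 fun hlarge => hdev ⟨B, ?_⟩
  rw [hcard]
  refine lt_of_lt_of_eq hlarge ?_
  congr!
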